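/- arXiv:2410.13737 — 5 statements merged into one kernel-verified Lean document; each statement's English description precedes it below -/
import Mathlib

section
/- Let U : ℝ^d → ℝ be measurable with U(x) ≥ U* for all x, where U* ∈ ℝ, and fix ε ∈ (0, 1/2). Let μ and ν be probability measures on ℝ^d such that U is μ-integrable with ∫ U dμ − U* ≤ ε/6, and such that KL(ν ‖ μ) ≤ ε²/18. If X is a random vector with law ν, then ℙ( U(X) − U* ≥ ε ) ≤ exp(−ε²/18). -/
open MeasureTheory ENNReal Classical

/-- The Kullback–Leibler divergence `KL(ν‖μ) = ∫ log(dν/dμ) dν`, equal to `+∞` if `ν` is not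
absolutely continuous with respect to `μ` (or if the log-likelihood ratio is not integrable). -/
noncomputable def klDiv {α : Type*} [MeasurableSpace α] (ν μ : Measure α) : ℝ≥0∞ :=
  if ν ≪ μ ∧ Integrable (llr ν μ) ν then ENNReal.ofReal (∫ x, llr ν μ x ∂ν) else ⊤

/-- The Young-type inequality `y * r ≤ r * log r - r + exp y` for `r ≥ 0`. -/
theorem mul_le_mul_log_sub_add_exp {r : ℝ} (hr : 0 ≤ r) (y : ℝ) :
    y * r ≤ r * Real.log r - r + Real.exp y := by
  rcases hr.eq_or_lt with rfl | hr
  · simpa using Real.exp_nonneg y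
  · have h := Real.add_one_le_exp (y - Real.log r)
    rw [Real.exp_sub, Real.exp_log hr, le_div_iff₀ hr] at h
    linarith

/-- A Donsker–Varadhan type bound: the probability of an event under `ν` is controlled by its
probability under `μ` and the Kullback–Leibler divergence of `ν` from `μ`. -/
theorem measureReal_le_integral_llr_add {α : Type*} [MeasurableSpace α] {ν μ : Measure α}
    [IsProbabilityMeasure ν] [IsProbabilityMeasure μ] (hνμ : ν ≪ μ)
    (hint : Integrable (llr ν μ) ν) {A : Set α} (hA : MeasurableSet A) :
    ν.real A ≤ ∫ x, llr ν μ x ∂ν + (Real.exp 1 - 1) * μ.real A := by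
  set r : α → ℝ := fun x ↦ (ν.rnDeriv μ x).toReal
  have hr : Integrable r μ := Measure.integrable_toReal_rnDeriv
  have hlog : Integrable (fun x ↦ r x * Real.log (r x)) μ :=
    (integrable_rnDeriv_mul_log_iff hνμ).2 hint
  have hind : Integrable (A.indicator fun _ ↦ Real.exp 1 - 1) μ :=
    (integrable_const _).indicator hA
  have hpoint (x : α) : A.indicator r x ≤
      r x * Real.log (r x) - r x + (1 + A.indicator (fun _ ↦ Real.exp 1 - 1) x) := by
    have hrx : 0 ≤ r x := ENNReal.toReal_nonneg
    by_cases hx : x ∈ A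
    · simpa [hx] using mul_le_mul_log_sub_add_exp hrx 1
    · simpa [hx] using mul_le_mul_log_sub_add_exp hrx 0
  have hmono := integral_mono (hr.indicator hA)
    ((hlog.sub hr).add ((integrable_const (1 : ℝ)).add hind)) hpoint
  rw [integral_add' (hlog.sub hr) ((integrable_const (1 : ℝ)).add hind), integral_sub' hlog hr,
    integral_add' (integrable_const (1 : ℝ)) hind, integral_indicator hA, integral_indicator hA,
    Measure.setIntegral_toReal_rnDeriv hνμ, Measure.integral_toReal_rnDeriv hνμ,
    integral_rnDeriv_mul_log hνμ] at hmono
  simp only [integral_const, probReal_univ, smul_eq_mul, measureReal_restrict_apply_univ] at hmono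
  linarith

/-- per-sample tail bound. If `U ≥ U*`, `∫ U dμ − U* ≤ ε/6`,
`KL(ν‖μ) ≤ ε²/18` with `ε ∈ (0, 1/2)`, and `X` has law `ν`, then
`ℙ(U(X) − U* ≥ ε) ≤ exp(−ε²/18)`. -/
theorem per_sample_tail_bound {d : ℕ} (U : EuclideanSpace ℝ (Fin d) → ℝ) (Ustar : ℝ)
    (hUmeas : Measurable U) (hUb : ∀ x, Ustar ≤ U x)
    (ε : ℝ) (hε : ε ∈ Set.Ioo (0 : ℝ) (1 / 2))
    (μ ν : Measure (EuclideanSpace ℝ (Fin d)))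
    [IsProbabilityMeasure μ] [IsProbabilityMeasure ν]
    (hUint : Integrable U μ) (hmean : (∫ x, U x ∂μ) - Ustar ≤ ε / 6)
    (hKL : klDiv ν μ ≤ ENNReal.ofReal (ε ^ 2 / 18))
    {Ω : Type*} [MeasurableSpace Ω] (P : Measure Ω) [IsProbabilityMeasure P]
    (X : Ω → EuclideanSpace ℝ (Fin d)) (hX : Measurable X) (hlaw : P.map X = ν) :
    P {ω | ε ≤ U (X ω) - Ustar} ≤ ENNReal.ofReal (Real.exp (-(ε ^ 2 / 18))) := by
  obtain ⟨hε0, hε1⟩ := hε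
  set A : Set (EuclideanSpace ℝ (Fin d)) := {x | ε ≤ U x - Ustar}
  have hA : MeasurableSet A := measurableSet_le measurable_const (hUmeas.sub_const _)
  have hP : P {ω | ε ≤ U (X ω) - Ustar} = ν A := by
    rw [← hlaw, Measure.map_apply hX hA]
    rfl
  have hac : ν ≪ μ ∧ Integrable (llr ν μ) ν := by
    by_contra h
    simp [klDiv, h] at hKL
  rw [klDiv, if_pos hac, ENNReal.ofReal_le_ofReal_iff (by positivity)] at hKL
  have hmarkov : ε * μ.real A ≤ ε / 6 := by
    have h := mul_meas_ge_le_integral_of_nonneg (μ := μ) (f := fun x ↦ U x - Ustar)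
      (.of_forall fun x ↦ sub_nonneg.2 (hUb x)) (hUint.sub (integrable_const _)) ε
    rw [integral_sub hUint (integrable_const _)] at h
    simp only [integral_const, probReal_univ, one_smul] at h
    exact h.trans hmean
  have hμA : μ.real A ≤ 1 / 6 := by nlinarith
  have hνA := measureReal_le_integral_llr_add hac.1 hac.2 hA
  have hexp := Real.add_one_le_exp (-(ε ^ 2 / 18))
  have he : (Real.exp 1 - 1) * μ.real A ≤ 2 * (1 / 6) :=
    mul_le_mul (by linarith [Real.exp_one_lt_d9]) hμA measureReal_nonneg (by norm_num)
  rw [hP, ← ofReal_measureReal]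
  exact ENNReal.ofReal_le_ofReal (by nlinarith)
end

section
/- Let U : ℝ^d → ℝ be twice continuously differentiable and let a, b, α, β, γ, σx², σy² > 0 satisfy a = β/σx², b = α/σy², and γ = a/b. Define p : ℝ^d × ℝ^d → ℝ by p(x, y) = exp(−aU(x) − b‖y‖²/2). Then for every (x, y) ∈ ℝ^d × ℝ^d, Σ_{i=1}^d ∂/∂x_i [ (−β ∂U/∂x_i(x) + y_i) · p(x,y) ] + Σ_{i=1}^d ∂/∂y_i [ (−γ ∂U/∂x_i(x) − α y_i) · p(x,y) ] = σx² Σ_{i=1}^d ∂²p/∂x_i²(x,y) + σy² Σ_{i=1}^d ∂²p/∂y_i²(x,y). -/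
/-- The partial derivative `∂F/∂x_i` of `F : ℝ^d × ℝ^d → ℝ` in the `i`-th coordinate of the
first (`x`) variable, at the point `z = (x, y)`. -/
noncomputable def pderivX {d : ℕ} (i : Fin d)
    (F : EuclideanSpace ℝ (Fin d) × EuclideanSpace ℝ (Fin d) → ℝ)
    (z : EuclideanSpace ℝ (Fin d) × EuclideanSpace ℝ (Fin d)) : ℝ :=
  fderiv ℝ (fun x => F (x, z.2)) z.1 (EuclideanSpace.single i 1)

/-- The partial derivative `∂F/∂y_i` of `F : ℝ^d × ℝ^d → ℝ` in the `i`-th coordinate of the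
second (`y`) variable, at the point `z = (x, y)`. -/
noncomputable def pderivY {d : ℕ} (i : Fin d)
    (F : EuclideanSpace ℝ (Fin d) × EuclideanSpace ℝ (Fin d) → ℝ)
    (z : EuclideanSpace ℝ (Fin d) × EuclideanSpace ℝ (Fin d)) : ℝ :=
  fderiv ℝ (fun y => F (z.1, y)) z.2 (EuclideanSpace.single i 1)

/-- Product rule for a function multiplied by the exponential of another one. -/
theorem fderiv_mul_exp_apply {E : Type*} [NormedAddCommGroup E] [NormedSpace ℝ E]
    {f φ : E → ℝ} {x : E} (hf : DifferentiableAt ℝ f x) (hφ : DifferentiableAt ℝ φ x) (v : E) :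
    fderiv ℝ (fun w => f w * Real.exp (φ w)) x v
      = (fderiv ℝ f x v + f x * fderiv ℝ φ x v) * Real.exp (φ x) := by
  rw [(hf.hasFDerivAt.fun_mul hφ.hasFDerivAt.exp).fderiv]
  simp only [add_apply, smul_apply, smul_eq_mul]
  ring

theorem fderiv_exp_apply {E : Type*} [NormedAddCommGroup E] [NormedSpace ℝ E]
    {φ : E → ℝ} {x : E} (hφ : DifferentiableAt ℝ φ x) (v : E) :
    fderiv ℝ (fun w => Real.exp (φ w)) x v = fderiv ℝ φ x v * Real.exp (φ x) := by
  simpa using fderiv_mul_exp_apply (differentiableAt_const (1 : ℝ)) hφ v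

theorem hasFDerivAt_euclideanSpace_apply {d : ℕ} (i : Fin d) (y : EuclideanSpace ℝ (Fin d)) :
    HasFDerivAt (fun w : EuclideanSpace ℝ (Fin d) => w i)
      (EuclideanSpace.proj i : EuclideanSpace ℝ (Fin d) →L[ℝ] ℝ) y :=
  (EuclideanSpace.proj i : EuclideanSpace ℝ (Fin d) →L[ℝ] ℝ).hasFDerivAt

/-- the unnormalized Gibbs density `p(x,y) = exp(−aU(x) − b‖y‖²/2)` satisfies the
stationary Fokker–Planck equation of the High-Resolution Langevin Dynamics, under the parameter
relations `a = β/σx²`, `b = α/σy²`, `γ = a/b`. -/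
theorem gibbs_density_stationary_fokker_planck {d : ℕ}
    (U : EuclideanSpace ℝ (Fin d) → ℝ) (hU : ContDiff ℝ 2 U)
    (a b α β γ σx2 σy2 : ℝ)
    (ha : 0 < a) (hb : 0 < b) (hα : 0 < α) (hβ : 0 < β) (hγ : 0 < γ)
    (hσx : 0 < σx2) (hσy : 0 < σy2)
    (h1 : a = β / σx2) (h2 : b = α / σy2) (h3 : γ = a / b)
    (p : EuclideanSpace ℝ (Fin d) × EuclideanSpace ℝ (Fin d) → ℝ)
    (hp : ∀ z, p z = Real.exp (-a * U z.1 - b * ‖z.2‖ ^ 2 / 2))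
    (x y : EuclideanSpace ℝ (Fin d)) :
    (∑ i : Fin d, pderivX i
        (fun z => (-β * fderiv ℝ U z.1 (EuclideanSpace.single i 1) + z.2 i) * p z) (x, y))
    + (∑ i : Fin d, pderivY i
        (fun z => (-γ * fderiv ℝ U z.1 (EuclideanSpace.single i 1) - α * z.2 i) * p z) (x, y))
    = σx2 * (∑ i : Fin d, pderivX i (fun z => pderivX i p z) (x, y))
      + σy2 * (∑ i : Fin d, pderivY i (fun z => pderivY i p z) (x, y)) := by
  obtain rfl : p = fun z => Real.exp (-a * U z.1 - b * ‖z.2‖ ^ 2 / 2) := funext hp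
  have hβ' : β = a * σx2 := by rw [h1]; field_simp
  have hα' : α = b * σy2 := by rw [h2]; field_simp
  have hγb : γ * b = a := by rw [h3]; field_simp
  have hUd : Differentiable ℝ U := hU.differentiable (by norm_num)
  have hφX (x y : EuclideanSpace ℝ (Fin d)) :
      HasFDerivAt (fun w => -a * U w - b * ‖y‖ ^ 2 / 2) (-a • fderiv ℝ U x) x :=
    ((hUd x).hasFDerivAt.const_mul (-a)).sub_const _
  have hφY (x y : EuclideanSpace ℝ (Fin d)) :
      HasFDerivAt (fun w => -a * U x - b * ‖w‖ ^ 2 / 2) (-b • innerSL ℝ y) y := by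
    have h := ((hasStrictFDerivAt_norm_sq y).hasFDerivAt.const_mul (b / 2)).const_sub (-a * U x)
    simp only [div_mul_eq_mul_div] at h
    refine h.congr_fderiv ?_
    ext w
    simp
    ring
  rw [Finset.mul_sum, Finset.mul_sum, ← Finset.sum_add_distrib, ← Finset.sum_add_distrib]
  refine Finset.sum_congr rfl fun i _ => ?_
  have hg : DifferentiableAt ℝ (fun w => fderiv ℝ U w (EuclideanSpace.single i 1)) x :=
    ((hU.fderiv_right (m := 1) (by norm_num)).differentiable (by norm_num) x).clm_apply
      (differentiableAt_const _)
  have hy := hasFDerivAt_euclideanSpace_apply i y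
  have hpX (x y : EuclideanSpace ℝ (Fin d)) :
      fderiv ℝ (fun w => Real.exp (-a * U w - b * ‖y‖ ^ 2 / 2)) x (EuclideanSpace.single i 1)
        = -a * fderiv ℝ U x (EuclideanSpace.single i 1)
          * Real.exp (-a * U x - b * ‖y‖ ^ 2 / 2) := by
    rw [fderiv_exp_apply (hφX x y).differentiableAt, (hφX x y).fderiv]
    simp
  have hpY (x y : EuclideanSpace ℝ (Fin d)) :
      fderiv ℝ (fun w => Real.exp (-a * U x - b * ‖w‖ ^ 2 / 2)) y (EuclideanSpace.single i 1)
        = -b * y i * Real.exp (-a * U x - b * ‖y‖ ^ 2 / 2) := by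
    rw [fderiv_exp_apply (hφY x y).differentiableAt, (hφY x y).fderiv]
    simp [EuclideanSpace.inner_single_right]
  simp only [pderivX, pderivY, hpX, hpY]
  rw [fderiv_mul_exp_apply ((hg.const_mul _).add_const _) (hφX x y).differentiableAt,
    fderiv_mul_exp_apply ((hy.const_mul α).const_sub _).differentiableAt
      (hφY x y).differentiableAt,
    fderiv_mul_exp_apply (hg.const_mul _) (hφX x y).differentiableAt,
    fderiv_mul_exp_apply (hy.const_mul (-b)).differentiableAt (hφY x y).differentiableAt,
    (hφX x y).fderiv, (hφY x y).fderiv, ((hg.hasFDerivAt.const_mul (-β)).add_const _).fderiv,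
    ((hy.const_mul α).const_sub _).fderiv, (hg.hasFDerivAt.const_mul (-a)).fderiv,
    (hy.const_mul (-b)).fderiv]
  simp [EuclideanSpace.inner_single_right]
  rw [hβ', hα', ← hγb]
  ring
end

section
/- Let U : ℝ^d → ℝ be twice continuously differentiable and let a, b, α, β, γ, σx², σy² > 0 satisfy a = β/σx², b = α/σy², and γ = a/b. Define p(x, y) = exp(−aU(x) − b‖y‖²/2), and let q : ℝ^d × ℝ^d → ℝ be a strictly positive twice continuously differentiable function. Write g_x = ∇_x log(q/p) and g_y = ∇_y log(q/p) for the gradients in the x- and y-variables of log(q/p). Then for every (x, y) ∈ ℝ^d × ℝ^d, − Σ_{i=1}^d ∂/∂x_i [ (−β ∂U/∂x_i(x) + y_i) q ] − Σ_{i=1}^d ∂/∂y_i [ (−γ ∂U/∂x_i(x) − α y_i) q ] + σx² Σ_{i=1}^d ∂²q/∂x_i² + σy² Σ_{i=1}^d ∂²q/∂y_i² = Σ_{i=1}^d ∂/∂x_i [ ( σx² (g_x)_i − (1/b) (g_y)_i ) q ] + Σ_{i=1}^d ∂/∂y_i [ ( (1/b) (g_x)_i + σy² (g_y)_i ) q ].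 -/
theorem pderivX_eq_fderiv {d : ℕ} (i : Fin d)
    {F : EuclideanSpace ℝ (Fin d) × EuclideanSpace ℝ (Fin d) → ℝ}
    {z : EuclideanSpace ℝ (Fin d) × EuclideanSpace ℝ (Fin d)} (hF : DifferentiableAt ℝ F z) :
    pderivX i F z = fderiv ℝ F z (EuclideanSpace.single i 1, 0) := by
  have h : HasFDerivAt F (fderiv ℝ F z) (z.1, z.2) := hF.hasFDerivAt
  have h' := h.comp z.1 (hasFDerivAt_prodMk_left (𝕜 := ℝ) z.1 z.2)
  have e : fderiv ℝ (fun x => F (x, z.2)) z.1 = _ := h'.fderiv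
  simp [pderivX, e]

theorem pderivY_eq_fderiv {d : ℕ} (i : Fin d)
    {F : EuclideanSpace ℝ (Fin d) × EuclideanSpace ℝ (Fin d) → ℝ}
    {z : EuclideanSpace ℝ (Fin d) × EuclideanSpace ℝ (Fin d)} (hF : DifferentiableAt ℝ F z) :
    pderivY i F z = fderiv ℝ F z (0, EuclideanSpace.single i 1) := by
  have h : HasFDerivAt F (fderiv ℝ F z) (z.1, z.2) := hF.hasFDerivAt
  have h' := h.comp z.2 (hasFDerivAt_prodMk_right (𝕜 := ℝ) z.1 z.2)
  have e : fderiv ℝ (fun y => F (z.1, y)) z.2 = _ := h'.fderiv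
  simp [pderivY, e]

/-- The partial derivatives of `log (q / p)` for `p = exp (-a U(x) - b ‖y‖² / 2)`. -/
theorem pderiv_log_div_gibbs {d : ℕ} {U : EuclideanSpace ℝ (Fin d) → ℝ}
    (hU : Differentiable ℝ U) {a b : ℝ}
    {p q : EuclideanSpace ℝ (Fin d) × EuclideanSpace ℝ (Fin d) → ℝ}
    (hp : ∀ z, p z = Real.exp (-a * U z.1 - b * ‖z.2‖ ^ 2 / 2))
    (hqpos : ∀ z, 0 < q z) (hq : Differentiable ℝ q) (i : Fin d)
    (z : EuclideanSpace ℝ (Fin d) × EuclideanSpace ℝ (Fin d)) :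
    pderivX i (fun w => Real.log (q w / p w)) z * q z
        = pderivX i q z + a * (fderiv ℝ U z.1 (EuclideanSpace.single i 1) * q z) ∧
      pderivY i (fun w => Real.log (q w / p w)) z * q z
        = pderivY i q z + b * (z.2 i * q z) := by
  have hlog : (fun w => Real.log (q w / p w))
      = fun w => Real.log (q w) + (a * U w.1 + b / 2 * ‖w.2‖ ^ 2) := by
    funext w
    rw [Real.log_div (hqpos w).ne' (by rw [hp]; positivity), hp, Real.log_exp]
    ring
  have hd : HasFDerivAt (fun w => Real.log (q w) + (a * U w.1 + b / 2 * ‖w.2‖ ^ 2)) _ z :=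
    ((hq z).hasFDerivAt.log (hqpos z).ne').add
      ((((hU z.1).hasFDerivAt.comp z hasFDerivAt_fst).const_mul a).add
        ((hasFDerivAt_snd (𝕜 := ℝ) (p := z)).norm_sq.const_mul (b / 2)))
  have hz := (hqpos z).ne'
  rw [hlog, pderivX_eq_fderiv i hd.differentiableAt, pderivY_eq_fderiv i hd.differentiableAt,
    pderivX_eq_fderiv i (hq z), pderivY_eq_fderiv i (hq z), hd.fderiv]
  constructor
  · simp
    field_simp
  · simp [EuclideanSpace.inner_single_right]
    field_simp

/-- rewriting of the Fokker–Planck operator applied to a positive smooth density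
`q` as the divergence of `M ∇log(q/p) · q`, where `M = [[σx² I, −(1/b) I], [(1/b) I, σy² I]]`
and `p(x,y) = exp(−aU(x) − b‖y‖²/2)`, under `a = β/σx²`, `b = α/σy²`, `γ = a/b`. -/
theorem fokker_planck_rewriting {d : ℕ}
    (U : EuclideanSpace ℝ (Fin d) → ℝ) (hU : ContDiff ℝ 2 U)
    (a b α β γ σx2 σy2 : ℝ)
    (ha : 0 < a) (hb : 0 < b) (hα : 0 < α) (hβ : 0 < β) (hγ : 0 < γ)
    (hσx : 0 < σx2) (hσy : 0 < σy2)
    (h1 : a = β / σx2) (h2 : b = α / σy2) (h3 : γ = a / b)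
    (p : EuclideanSpace ℝ (Fin d) × EuclideanSpace ℝ (Fin d) → ℝ)
    (hp : ∀ z, p z = Real.exp (-a * U z.1 - b * ‖z.2‖ ^ 2 / 2))
    (q : EuclideanSpace ℝ (Fin d) × EuclideanSpace ℝ (Fin d) → ℝ)
    (hqpos : ∀ z, 0 < q z) (hq : ContDiff ℝ 2 q)
    (x y : EuclideanSpace ℝ (Fin d)) :
    -(∑ i : Fin d, pderivX i
        (fun z => (-β * fderiv ℝ U z.1 (EuclideanSpace.single i 1) + z.2 i) * q z) (x, y))
    - (∑ i : Fin d, pderivY i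
        (fun z => (-γ * fderiv ℝ U z.1 (EuclideanSpace.single i 1) - α * z.2 i) * q z) (x, y))
    + σx2 * (∑ i : Fin d, pderivX i (fun z => pderivX i q z) (x, y))
    + σy2 * (∑ i : Fin d, pderivY i (fun z => pderivY i q z) (x, y))
    = (∑ i : Fin d, pderivX i
        (fun z => (σx2 * pderivX i (fun w => Real.log (q w / p w)) z
          - (1 / b) * pderivY i (fun w => Real.log (q w / p w)) z) * q z) (x, y))
      + (∑ i : Fin d, pderivY i
        (fun z => ((1 / b) * pderivX i (fun w => Real.log (q w / p w)) z
          + σy2 * pderivY i (fun w => Real.log (q w / p w)) z) * q z) (x, y)) := by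
  have hUd : Differentiable ℝ U := hU.differentiable (by norm_num)
  have hqd : Differentiable ℝ q := hq.differentiable (by norm_num)
  have hdU : Differentiable ℝ (fderiv ℝ U) :=
    (hU.fderiv_right (m := 1) (by norm_num)).differentiable (by norm_num)
  have hdq : Differentiable ℝ (fderiv ℝ q) :=
    (hq.fderiv_right (m := 1) (by norm_num)).differentiable (by norm_num)
  have hβ' : σx2 * a = β := by rw [h1]; field_simp
  have hα' : σy2 * b = α := by rw [h2]; field_simp
  rw [Finset.mul_sum, Finset.mul_sum, ← Finset.sum_neg_distrib, ← Finset.sum_sub_distrib,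
    ← Finset.sum_add_distrib, ← Finset.sum_add_distrib, ← Finset.sum_add_distrib]
  refine Finset.sum_congr rfl fun i _ => ?_
  have hg := pderiv_log_div_gibbs hUd hp hqpos hqd i
  have hX : (fun z => pderivX i q z) = fun z => fderiv ℝ q z (EuclideanSpace.single i 1, 0) :=
    funext fun z => pderivX_eq_fderiv i (hqd z)
  have hY : (fun z => pderivY i q z) = fun z => fderiv ℝ q z (0, EuclideanSpace.single i 1) :=
    funext fun z => pderivY_eq_fderiv i (hqd z)
  set A : EuclideanSpace ℝ (Fin d) × EuclideanSpace ℝ (Fin d) → ℝ :=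
    fun z => pderivX i q z with hA
  set B : EuclideanSpace ℝ (Fin d) × EuclideanSpace ℝ (Fin d) → ℝ :=
    fun z => pderivY i q z with hB
  let C : EuclideanSpace ℝ (Fin d) × EuclideanSpace ℝ (Fin d) → ℝ :=
    fun z => fderiv ℝ U z.1 (EuclideanSpace.single i 1) * q z
  let D : EuclideanSpace ℝ (Fin d) × EuclideanSpace ℝ (Fin d) → ℝ := fun z => z.2 i * q z
  have dA : Differentiable ℝ A := by rw [hX]; fun_prop
  have dB : Differentiable ℝ B := by rw [hY]; fun_prop
  have dC : Differentiable ℝ C := by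
    have : Differentiable ℝ fun z : EuclideanSpace ℝ (Fin d) × EuclideanSpace ℝ (Fin d) =>
      fderiv ℝ U z.1 := hdU.comp differentiable_fst
    fun_prop
  have dD : Differentiable ℝ D := by fun_prop
  have comb (c₁ c₂ c₃ c₄ : ℝ) (z : EuclideanSpace ℝ (Fin d) × EuclideanSpace ℝ (Fin d)) :
      HasFDerivAt (fun z => c₁ * A z + c₂ * B z + c₃ * C z + c₄ * D z)
        (c₁ • fderiv ℝ A z + c₂ • fderiv ℝ B z + c₃ • fderiv ℝ C z + c₄ • fderiv ℝ D z) z :=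
    ((((dA z).hasFDerivAt.const_mul c₁).add ((dB z).hasFDerivAt.const_mul c₂)).add
      ((dC z).hasFDerivAt.const_mul c₃)).add ((dD z).hasFDerivAt.const_mul c₄)
  have e₁ : (fun z : EuclideanSpace ℝ (Fin d) × EuclideanSpace ℝ (Fin d) =>
      (-β * fderiv ℝ U z.1 (EuclideanSpace.single i 1) + z.2 i) * q z)
      = fun z => 0 * A z + 0 * B z + (-β) * C z + 1 * D z := by
    funext z; simp only [C, D]; ring
  have e₂ : (fun z : EuclideanSpace ℝ (Fin d) × EuclideanSpace ℝ (Fin d) =>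
      (-γ * fderiv ℝ U z.1 (EuclideanSpace.single i 1) - α * z.2 i) * q z)
      = fun z => 0 * A z + 0 * B z + (-γ) * C z + (-α) * D z := by
    funext z; simp only [C, D]; ring
  have e₃ : (fun z => (σx2 * pderivX i (fun w => Real.log (q w / p w)) z
      - (1 / b) * pderivY i (fun w => Real.log (q w / p w)) z) * q z)
      = fun z => σx2 * A z + (-(1 / b)) * B z + β * C z + (-1) * D z := by
    funext z
    have hb' : 1 / b * b = 1 := by field_simp
    simp only [hA, hB, C, D]
    linear_combination σx2 * (hg z).1 - 1 / b * (hg z).2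
      + fderiv ℝ U z.1 (EuclideanSpace.single i 1) * q z * hβ' - z.2 i * q z * hb'
  have e₄ : (fun z => ((1 / b) * pderivX i (fun w => Real.log (q w / p w)) z
      + σy2 * pderivY i (fun w => Real.log (q w / p w)) z) * q z)
      = fun z => (1 / b) * A z + σy2 * B z + γ * C z + α * D z := by
    funext z
    simp only [hA, hB, C, D]
    linear_combination 1 / b * (hg z).1 + σy2 * (hg z).2
      - fderiv ℝ U z.1 (EuclideanSpace.single i 1) * q z * h3 + z.2 i * q z * hα'
  have hsymm : fderiv ℝ B (x, y) (EuclideanSpace.single i 1, 0)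
      = fderiv ℝ A (x, y) (0, EuclideanSpace.single i 1) := by
    have key (v w : EuclideanSpace ℝ (Fin d) × EuclideanSpace ℝ (Fin d)) :
        fderiv ℝ (fun z => fderiv ℝ q z v) (x, y) w = fderiv ℝ (fderiv ℝ q) (x, y) w v := by
      rw [fderiv_clm_apply (hdq _) (differentiableAt_const v)]
      simp
    rw [hX, hY, key, key]
    exact (hq.contDiffAt.isSymmSndFDerivAt (by simp)) _ _
  rw [e₁, e₂, e₃, e₄, pderivX_eq_fderiv i (comb _ _ _ _ _).differentiableAt,
    pderivY_eq_fderiv i (comb _ _ _ _ _).differentiableAt,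
    pderivX_eq_fderiv i (comb _ _ _ _ _).differentiableAt,
    pderivY_eq_fderiv i (comb _ _ _ _ _).differentiableAt,
    pderivX_eq_fderiv i (dA _), pderivY_eq_fderiv i (dB _),
    (comb _ _ _ _ _).fderiv, (comb _ _ _ _ _).fderiv, (comb _ _ _ _ _).fderiv,
    (comb _ _ _ _ _).fderiv]
  simp only [add_apply, smul_apply, smul_eq_mul]
  linear_combination (1 / b) * hsymm
end

section
/- Let U : ℝ^d → ℝ be twice continuously differentiable with L-Lipschitz gradient (L > 0), and let a > 0 be such that Z_a := ∫_{ℝ^d} exp(−aU(x)) dx ∈ (0, ∞). Assume that x ↦ ‖∇U(x)‖² exp(−aU(x)) and x ↦ ΔU(x) exp(−aU(x)) are Lebesgue-integrable on ℝ^d, and that the divergence-theorem identity ∫_{ℝ^d} div( exp(−aU(x)) ∇U(x) ) dx = 0 holds. Then (1/Z_a) ∫_{ℝ^d} ‖∇U(x)‖² exp(−aU(x)) dx ≤ d L / a. -/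
open MeasureTheory

/-- The Laplacian of `U : ℝ^d → ℝ` at `x`: the sum of the second partial derivatives
`∂²U/∂x_i²(x)`, i.e. the trace of the Hessian of `U` at `x`. -/
noncomputable def laplacian {d : ℕ} (U : EuclideanSpace ℝ (Fin d) → ℝ)
    (x : EuclideanSpace ℝ (Fin d)) : ℝ :=
  ∑ i : Fin d,
    fderiv ℝ (fun x' => fderiv ℝ U x' (EuclideanSpace.single i 1)) x (EuclideanSpace.single i 1)

/-- The divergence of a vector field `F : ℝ^d → ℝ^d` at `x`: `∑ i ∂F_i/∂x_i (x)`. -/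
noncomputable def divergence {d : ℕ} (F : EuclideanSpace ℝ (Fin d) → EuclideanSpace ℝ (Fin d))
    (x : EuclideanSpace ℝ (Fin d)) : ℝ :=
  ∑ i : Fin d, fderiv ℝ (fun x' => F x' i) x (EuclideanSpace.single i 1)

theorem gradient_apply_eq_fderiv_single {d : ℕ} (U : EuclideanSpace ℝ (Fin d) → ℝ)
    (x : EuclideanSpace ℝ (Fin d)) (i : Fin d) :
    gradient U x i = fderiv ℝ U x (EuclideanSpace.single i 1) := by
  have h : inner ℝ (gradient U x) (EuclideanSpace.single i (1 : ℝ))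
      = fderiv ℝ U x (EuclideanSpace.single i 1) := by
    simp [gradient, InnerProductSpace.toDual_symm_apply]
  rw [← h, EuclideanSpace.inner_single_right]
  simp

theorem ContDiff.differentiable_fderiv_single {d : ℕ} {U : EuclideanSpace ℝ (Fin d) → ℝ}
    (hU : ContDiff ℝ 2 U) (i : Fin d) :
    Differentiable ℝ fun x => fderiv ℝ U x (EuclideanSpace.single i 1) :=
  ((hU.fderiv_right (m := 1) (by norm_num)).clm_apply contDiff_const).differentiable (by norm_num)

/-- The Laplacian of a function with `K`-Lipschitz gradient is at most `d * K`. -/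
theorem laplacian_le_of_lipschitzWith_gradient {d : ℕ} {U : EuclideanSpace ℝ (Fin d) → ℝ}
    {K : NNReal} (hU : LipschitzWith K (gradient U)) (x : EuclideanSpace ℝ (Fin d)) :
    laplacian U x ≤ d * K := by
  have h : ∀ i ∈ Finset.univ, fderiv ℝ (fun x' => fderiv ℝ U x' (EuclideanSpace.single i 1)) x
      (EuclideanSpace.single i 1) ≤ (K : ℝ) := by
    intro i _
    have hlip : LipschitzWith K fun x' => fderiv ℝ U x' (EuclideanSpace.single i 1) := by
      refine LipschitzWith.of_dist_le_mul fun y z => ?_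
      refine le_trans ?_ (hU.dist_le_mul y z)
      rw [← gradient_apply_eq_fderiv_single, ← gradient_apply_eq_fderiv_single, dist_eq_norm,
        dist_eq_norm]
      exact PiLp.norm_apply_le (gradient U y - gradient U z) i
    calc _ ≤ ‖fderiv ℝ (fun x' => fderiv ℝ U x' (EuclideanSpace.single i 1)) x
          (EuclideanSpace.single i 1)‖ := Real.le_norm_self _
      _ ≤ K * ‖EuclideanSpace.single i (1 : ℝ)‖ :=
          ContinuousLinearMap.le_of_opNorm_le _ (norm_fderiv_le_of_lipschitz ℝ hlip) _
      _ = K := by simp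
  simpa [laplacian] using Finset.sum_le_sum h

theorem divergence_exp_smul_gradient {d : ℕ} {U : EuclideanSpace ℝ (Fin d) → ℝ}
    (hU : ContDiff ℝ 2 U) (a : ℝ) (x : EuclideanSpace ℝ (Fin d)) :
    divergence (fun x' => Real.exp (-a * U x') • gradient U x') x =
      laplacian U x * Real.exp (-a * U x) - a * (‖gradient U x‖ ^ 2 * Real.exp (-a * U x)) := by
  rw [EuclideanSpace.real_norm_sq_eq, divergence, laplacian, Finset.sum_mul, Finset.sum_mul,
    Finset.mul_sum, ← Finset.sum_sub_distrib]
  refine Finset.sum_congr rfl fun i _ => ?_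
  have hexp : HasFDerivAt (fun x' => Real.exp (-a * U x'))
      (Real.exp (-a * U x) • (-a) • fderiv ℝ U x) x :=
    ((hU.differentiable (by norm_num) x).hasFDerivAt.const_mul (-a)).exp
  have h := (hexp.mul (hU.differentiable_fderiv_single i x).hasFDerivAt).fderiv
  simp only [PiLp.smul_apply, smul_eq_mul, gradient_apply_eq_fderiv_single]
  refine (DFunLike.congr_fun h _).trans ?_
  simp only [add_apply, smul_apply, smul_eq_mul]
  ring

/-- the Gibbs moment bound `E_{μ^a}[‖∇U‖²] ≤ dL/a`, proved by integration by
parts (assumed here in the form of the divergence-theorem identity). -/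
theorem gibbs_grad_sq_moment {d : ℕ} (U : EuclideanSpace ℝ (Fin d) → ℝ)
    (L : ℝ) (hL : 0 < L) (hU : ContDiff ℝ 2 U)
    (hUlip : LipschitzWith L.toNNReal (gradient U))
    (a : ℝ) (ha : 0 < a)
    (hZint : Integrable (fun x => Real.exp (-a * U x)) volume)
    (Za : ℝ) (hZa : Za = ∫ x, Real.exp (-a * U x)) (hZpos : 0 < Za)
    (hint1 : Integrable (fun x => ‖gradient U x‖ ^ 2 * Real.exp (-a * U x)) volume)
    (hint2 : Integrable (fun x => laplacian U x * Real.exp (-a * U x)) volume)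
    (hdiv : ∫ x, divergence (fun x' => Real.exp (-a * U x') • gradient U x') x = 0) :
    (1 / Za) * ∫ x, ‖gradient U x‖ ^ 2 * Real.exp (-a * U x) ≤ d * L / a := by
  simp_rw [divergence_exp_smul_gradient hU] at hdiv
  rw [integral_sub hint2 (hint1.const_mul a), integral_const_mul, sub_eq_zero] at hdiv
  have hle : ∫ x, laplacian U x * Real.exp (-a * U x) ≤ d * L * Za := by
    rw [hZa, ← integral_const_mul]
    refine integral_mono hint2 (hZint.const_mul _) fun x => ?_
    have h := laplacian_le_of_lipschitzWith_gradient hUlip x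
    rw [Real.coe_toNNReal L hL.le] at h
    exact mul_le_mul_of_nonneg_right h (Real.exp_pos _).le
  rw [one_div_mul_eq_div, div_le_div_iff₀ hZpos ha]
  linarith
end

section
/- Let h > 0, θ > 0 with θ·h ≤ 1, and P, Q ≥ 0. Let g : ℝ → ℝ be differentiable on [0, h] such that for all t ∈ [0, h], g′(t) ≤ −θ·g(t) + P·t² + Q·t. Then g(h) ≤ e^{−θh} · ( g(0) + 2P·h³ + 2Q·h² ). -/
/-- Grönwall's inequality with a constant forcing term: if `g' ≤ -θ g + C` on `[0, h]`, then
`e^{θ h} g h ≤ g 0 + C (e^{θ h} - 1) / θ`. -/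
theorem exp_mul_le_of_deriv_le_neg_mul_add {h θ C : ℝ} (hh : 0 ≤ h) (hθ : θ ≠ 0) {g g' : ℝ → ℝ}
    (hg : ∀ t ∈ Set.Icc (0 : ℝ) h, HasDerivWithinAt g (g' t) (Set.Icc 0 h) t)
    (hineq : ∀ t ∈ Set.Icc (0 : ℝ) h, g' t ≤ -θ * g t + C) :
    Real.exp (θ * h) * g h ≤ g 0 + C * ((Real.exp (θ * h) - 1) / θ) := by
  have hderiv : ∀ t ∈ Set.Icc (0 : ℝ) h,
      HasDerivWithinAt (fun t => Real.exp (θ * t) * (g t - C / θ))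
        (Real.exp (θ * t) * (θ * g t + g' t - C)) (Set.Icc 0 h) t := by
    intro t ht
    have hexp : HasDerivAt (fun t => Real.exp (θ * t)) (Real.exp (θ * t) * (θ * 1)) t :=
      ((hasDerivAt_id t).const_mul θ).exp
    refine (hexp.hasDerivWithinAt.mul ((hg t ht).sub_const (C / θ))).congr_deriv ?_
    field_simp
    ring
  have hanti : AntitoneOn (fun t => Real.exp (θ * t) * (g t - C / θ)) (Set.Icc 0 h) := by
    refine antitoneOn_of_hasDerivWithinAt_nonpos (convex_Icc 0 h)
      (fun t ht => (hderiv t ht).continuousWithinAt)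
      (fun t ht => (hderiv t (interior_subset ht)).mono interior_subset) fun t ht => ?_
    exact mul_nonpos_of_nonneg_of_nonpos (Real.exp_pos _).le
      (by linarith [hineq t (interior_subset ht)])
  have hle := hanti (Set.left_mem_Icc.2 hh) (Set.right_mem_Icc.2 hh) hh
  simp only [mul_zero, Real.exp_zero, one_mul] at hle
  linear_combination hle


/-- Grönwall-type differential inequality. If `g` is differentiable on `[0, h]`
with derivative `g'` satisfying `g' t ≤ -θ g t + P t² + Q t` there, with `θ h ≤ 1`, then
`g h ≤ e^{-θ h} (g 0 + 2 P h³ + 2 Q h²)`. -/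
theorem gronwall_step (h θ P Q : ℝ) (hh : 0 < h) (hθ : 0 < θ) (hθh : θ * h ≤ 1)
    (hP : 0 ≤ P) (hQ : 0 ≤ Q) (g g' : ℝ → ℝ)
    (hg : ∀ t ∈ Set.Icc (0 : ℝ) h, HasDerivWithinAt g (g' t) (Set.Icc 0 h) t)
    (hineq : ∀ t ∈ Set.Icc (0 : ℝ) h, g' t ≤ -θ * g t + P * t ^ 2 + Q * t) :
    g h ≤ Real.exp (-θ * h) * (g 0 + 2 * P * h ^ 3 + 2 * Q * h ^ 2) := by
  have hforce : ∀ t ∈ Set.Icc (0 : ℝ) h, g' t ≤ -θ * g t + (P * h ^ 2 + Q * h) := by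
    intro t ht
    have hsq : P * t ^ 2 ≤ P * h ^ 2 :=
      mul_le_mul_of_nonneg_left (pow_le_pow_left₀ ht.1 ht.2 2) hP
    have hlin : Q * t ≤ Q * h := mul_le_mul_of_nonneg_left ht.2 hQ
    linarith [hineq t ht]
  have hexp : (Real.exp (θ * h) - 1) / θ ≤ 2 * h := by
    have hpos : 0 ≤ θ * h := by positivity
    have habs := Real.abs_exp_sub_one_le (x := θ * h) (by rwa [abs_of_nonneg hpos])
    rw [abs_of_nonneg hpos] at habs
    rw [div_le_iff₀ hθ]
    linarith [le_of_abs_le habs]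
  have hmain := exp_mul_le_of_deriv_le_neg_mul_add hh.le hθ.ne' hg hforce
  have hC : 0 ≤ P * h ^ 2 + Q * h := by positivity
  rw [neg_mul, Real.exp_neg, ← div_eq_inv_mul, le_div_iff₀' (Real.exp_pos _)]
  linarith [mul_le_mul_of_nonneg_left hexp hC]
end
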